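/- arXiv:0802.0359 — 10 statements merged into one kernel-verified Lean document; each statement's English description precedes it below -/
import Mathlib

section
/- For every x ∈ ℝⁿ, s ∈ ℝ, a, b ∈ ℝ, and u, v ∈ ℝⁿ satisfying Σ_j λ_j x_j u_j = 0 and Σ_j λ_j x_j v_j = 0, one has ω(P, Q) = 0, where P = (u_1 e^{iλ_1 s} + i a λ_1 x_1 e^{iλ_1 s}, …, u_n e^{iλ_n s} + i a λ_n x_n e^{iλ_n s}) and Q = (v_1 e^{iλ_1 s} + i b λ_1 x_1 e^{iλ_1 s}, …, v_n e^{iλ_n s} + i b λ_n x_n e^{iλ_n s}). In other words, the tangent planes of each level set L_C = {F(x,s) : Σ_j λ_j x_j² = C} are Lagrangian subspaces of ℂⁿ. -/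
open Complex

/-- Multiplying both arguments by the same phase `e^{iθ}` does not change `Im (conj p * q)`. -/
theorem im_conj_mul_exp_mul_exp (θ : ℝ) (p q : ℂ) :
    ((starRingEnd ℂ) (p * exp (θ * I)) * (q * exp (θ * I))).im =
      ((starRingEnd ℂ) p * q).im := by
  have h : (starRingEnd ℂ) (exp (θ * I)) * exp (θ * I) = 1 := by
    rw [conj_mul', norm_exp_ofReal_mul_I]
    simp
  rw [map_mul, mul_mul_mul_comm, h, mul_one]

/-- The tangent planes of each level set `L_C = {F(x,s) : ∑ λ_j x_j² = C}` of the
parametrization `F(x,s) = (x_1 e^{iλ_1 s}, …, x_n e^{iλ_n s})` are Lagrangian subspaces of ℂⁿ: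
for tangent vectors `P = (u_j e^{iλ_j s} + i a λ_j x_j e^{iλ_j s})_j` and
`Q = (v_j e^{iλ_j s} + i b λ_j x_j e^{iλ_j s})_j` with `∑ λ_j x_j u_j = 0 = ∑ λ_j x_j v_j`,
the standard symplectic form `ω(P,Q) = ∑ Im(conj(P_j) Q_j)` vanishes. -/
theorem stmt0 (n : ℕ) (hn : 2 ≤ n) (lam : Fin n → ℝ) (hlam : ∀ j, lam j ≠ 0)
    (x : Fin n → ℝ) (s a b : ℝ) (u v : Fin n → ℝ)
    (hu : ∑ j, lam j * x j * u j = 0) (hv : ∑ j, lam j * x j * v j = 0) :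
    ∑ j, ((starRingEnd ℂ)
        ((u j : ℂ) * Complex.exp (Complex.I * lam j * s)
          + Complex.I * a * lam j * x j * Complex.exp (Complex.I * lam j * s)) *
        ((v j : ℂ) * Complex.exp (Complex.I * lam j * s)
          + Complex.I * b * lam j * x j * Complex.exp (Complex.I * lam j * s))).im = 0 := by
  have key (j : Fin n) : ((starRingEnd ℂ)
        ((u j : ℂ) * Complex.exp (Complex.I * lam j * s)
          + Complex.I * a * lam j * x j * Complex.exp (Complex.I * lam j * s)) *
        ((v j : ℂ) * Complex.exp (Complex.I * lam j * s)
          + Complex.I * b * lam j * x j * Complex.exp (Complex.I * lam j * s))).im =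
      b * (lam j * x j * u j) - a * (lam j * x j * v j) := by
    have hphase : I * lam j * s = ((lam j * s : ℝ) : ℂ) * I := by
      push_cast
      ring
    rw [hphase, ← add_mul, ← add_mul, im_conj_mul_exp_mul_exp]
    simp
    ring
  simp_rw [key]
  rw [Finset.sum_sub_distrib, ← Finset.mul_sum, ← Finset.mul_sum, hu, hv]
  simp
end

section
/- Let x ∈ ℝⁿ, x ≠ 0, and s ∈ ℝ. If v_1, …, v_n is any basis of the tangent plane T(x,s) that is orthonormal with respect to the real inner product on ℂⁿ, then the complex determinant of the n × n complex matrix with columns v_1, …, v_n equals ε · i · e^{iΛ s} for some ε ∈ {1, −1}, where Λ = Σ_j λ_j. In particular, when Λ = 0 this determinant lies in {i, −i} independently of (x,s), i.e. the Lagrangian angle is constant (the submanifold is special Lagrangian). -/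
open Complex

open Matrix in
/-- If the columns `u i + a i • w` with `u i` orthogonal to `w` are orthonormal, the determinant of
the matrix they form is `±1`. -/
theorem det_add_vecMulVec_eq_one_or_neg_one {ι : Type*} [Fintype ι] [DecidableEq ι]
    (u : ι → ι → ℝ) (a w : ι → ℝ) (hwu : ∀ i, w ⬝ᵥ u i = 0)
    (hON : ∀ i i', u i ⬝ᵥ u i' + a i * a i' * (w ⬝ᵥ w) = if i = i' then (1 : ℝ) else 0) :
    ((of u)ᵀ + vecMulVec w a).det = 1 ∨ ((of u)ᵀ + vecMulVec w a).det = -1 := by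
  rw [← sq_eq_one_iff, sq]
  nth_rewrite 1 [← det_transpose]
  rw [← det_mul]
  suffices h : ((of u)ᵀ + vecMulVec w a)ᵀ * ((of u)ᵀ + vecMulVec w a) = 1 by rw [h, det_one]
  ext i i'
  have huw : u i ⬝ᵥ w = 0 := by rw [dotProduct_comm, hwu]
  have hcol : ∀ k, (fun j => ((of u)ᵀ + vecMulVec w a) j k) = u k + a k • w := by
    intro k
    ext j
    simp [vecMulVec_apply, mul_comm]
  rw [mul_apply', one_apply, ← hON]
  change (fun j => ((of u)ᵀ + vecMulVec w a) j i) ⬝ᵥ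
    (fun j => ((of u)ᵀ + vecMulVec w a) j i') = _
  rw [hcol, hcol]
  simp only [add_dotProduct, dotProduct_add, smul_dotProduct, dotProduct_smul, huw, hwu,
    smul_eq_mul]
  ring

open Matrix in
/-- Rotating the `w`-component of the columns `u i + a i • w` by `I` multiplies the determinant
by `I`. -/
theorem det_add_I_smul_vecMulVec {ι : Type*} [Fintype ι] [DecidableEq ι]
    (u : ι → ι → ℝ) (a w : ι → ℝ) (hw : w ≠ 0) (hwu : ∀ i, w ⬝ᵥ u i = 0) :
    (of fun j i => (u i j : ℂ) + I * (w j * a i : ℝ)).det =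
      I * (((of u)ᵀ + vecMulVec w a).det : ℝ) := by
  have hww : ((w ⬝ᵥ w : ℝ) : ℂ) ≠ 0 := by
    exact_mod_cast fun h => hw (dotProduct_self_eq_zero.mp h)
  set W : ι → ℂ := fun j => w j with hW
  set c : ℂ := (I - 1) / (w ⬝ᵥ w : ℝ) with hc
  have hWW : W ⬝ᵥ W = (w ⬝ᵥ w : ℝ) := by simp [hW, dotProduct]
  have hfac : (of fun j i => (u i j : ℂ) + I * (w j * a i : ℝ)) =
      (1 + vecMulVec (c • W) W) * ((of u)ᵀ + vecMulVec w a).map ofRealHom := by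
    ext j i
    have hproj : W ⬝ᵥ (fun k => (((of u)ᵀ + vecMulVec w a).map ofRealHom) k i) =
        a i * (w ⬝ᵥ w : ℝ) := by
      have h : w ⬝ᵥ (u i + a i • w) = a i * (w ⬝ᵥ w) := by
        rw [dotProduct_add, hwu, dotProduct_smul, zero_add, smul_eq_mul]
      rw [← ofReal_mul, ← h]
      simp [hW, dotProduct, vecMulVec_apply, mul_comm]
    rw [Matrix.add_mul, Matrix.one_mul, vecMulVec_mul, Matrix.add_apply, vecMulVec_apply]
    change _ = _ + (c • W) j * (W ⬝ᵥ fun k => (((of u)ᵀ + vecMulVec w a).map ofRealHom) k i)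
    rw [hproj, hc]
    simp only [of_apply, map_apply, Matrix.add_apply, transpose_apply, vecMulVec_apply, ofRealHom_eq_coe,
      Pi.smul_apply, smul_eq_mul, hW]
    field_simp
    push_cast
    ring
  have hdet : (1 + vecMulVec (c • W) W).det = I := by
    rw [vecMulVec_eq Unit, det_one_add_replicateCol_mul_replicateRow, dotProduct_smul, hWW, hc,
      smul_eq_mul, div_mul_cancel₀ _ hww]
    ring
  rw [hfac, det_mul, hdet, ← RingHom.mapMatrix_apply, ← RingHom.map_det, ofRealHom_eq_coe]

/-- The real inner product on `ℂ` is invariant under multiplication by a unit complex number. -/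
theorem re_mul_conj_mul_exp (p q r t φ : ℝ) :
    (((p + I * q) * exp (I * φ)) * (starRingEnd ℂ) ((r + I * t) * exp (I * φ))).re =
      p * r + q * t := by
  have h : exp (I * φ) * (starRingEnd ℂ) (exp (I * φ)) = 1 := by
    rw [mul_conj, mul_comm I, normSq_eq_norm_sq, norm_exp_ofReal_mul_I]
    simp
  rw [map_mul, mul_mul_mul_comm, h]
  simp

/-- For `x ≠ 0`, if `v_1, …, v_n` are vectors in the tangent plane
`T(x,s) = {(u_j e^{iλ_j s} + i a λ_j x_j e^{iλ_j s})_j : ∑ λ_j x_j u_j = 0}` of the level set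
`L_C` which are orthonormal with respect to the real inner product `⟨z,w⟩ = Re ∑ z_j conj(w_j)`
(hence an orthonormal basis of the n-dimensional plane `T(x,s)`), then the complex determinant
of the matrix with columns `v_1, …, v_n` equals `ε i e^{iΛ s}` with `ε = ±1`, where
`Λ = ∑ λ_j`.  In particular for `Λ = 0` the Lagrangian angle is constant. -/
theorem stmt2 (n : ℕ) (hn : 2 ≤ n) (lam : Fin n → ℝ) (hlam : ∀ j, lam j ≠ 0)
    (x : Fin n → ℝ) (hx : x ≠ 0) (s : ℝ)
    (v : Fin n → Fin n → ℂ)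
    (hvT : ∀ i, ∃ (u : Fin n → ℝ) (a : ℝ), (∑ j, lam j * x j * u j = 0) ∧
      ∀ j, v i j = (u j : ℂ) * Complex.exp (Complex.I * lam j * s)
        + Complex.I * a * lam j * x j * Complex.exp (Complex.I * lam j * s))
    (hON : ∀ i i', (∑ j, (v i j * (starRingEnd ℂ) (v i' j)).re)
      = if i = i' then (1 : ℝ) else 0) :
    ∃ ε : ℝ, (ε = 1 ∨ ε = -1) ∧
      Matrix.det (Matrix.of fun j i => v i j)
        = (ε : ℂ) * Complex.I * Complex.exp (Complex.I * (∑ j, lam j) * s) := by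
  choose u a hu hv using hvT
  set w : Fin n → ℝ := fun j => lam j * x j with hw
  have hw0 : w ≠ 0 := by
    obtain ⟨j, hj⟩ := Function.ne_iff.mp hx
    exact Function.ne_iff.mpr ⟨j, mul_ne_zero (hlam j) hj⟩
  have hwu : ∀ i, w ⬝ᵥ u i = 0 := hu
  have hON' : ∀ i i', u i ⬝ᵥ u i' + a i * a i' * (w ⬝ᵥ w) = if i = i' then (1 : ℝ) else 0 := by
    intro i i'
    rw [← hON, dotProduct, dotProduct, Finset.mul_sum, ← Finset.sum_add_distrib]
    refine Finset.sum_congr rfl fun j _ => ?_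
    rw [hv, hv]
    have h := re_mul_conj_mul_exp (u i j) (a i * w j) (u i' j) (a i' * w j) (lam j * s)
    rw [show u i j * u i' j + a i * a i' * (w j * w j) =
      u i j * u i' j + a i * w j * (a i' * w j) by ring, ← h]
    push_cast [hw]
    ring_nf
  have hQ := det_add_vecMulVec_eq_one_or_neg_one u a w hwu hON'
  have hR := det_add_I_smul_vecMulVec u a w hw0 hwu
  refine ⟨_, hQ, ?_⟩
  have hD : (Matrix.of fun j i => v i j) =
      Matrix.diagonal (fun j => exp (I * lam j * s)) *
        Matrix.of fun j i => (u i j : ℂ) + I * (w j * a i : ℝ) := by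
    ext j i
    rw [Matrix.diagonal_mul, Matrix.of_apply, Matrix.of_apply, hv, hw]
    push_cast
    ring
  rw [hD, Matrix.det_mul, Matrix.det_diagonal, hR, ← Complex.exp_sum, ← Finset.sum_mul,
    ← Finset.mul_sum]
  push_cast
  ring
end

section
/- Let x ∈ ℝⁿ, x ≠ 0, with Σ_j λ_j x_j² = C, and let s ∈ ℝ. Then the orthogonal projection (with respect to the real inner product on ℂⁿ) of the position vector F(x,s) onto the orthogonal complement T(x,s)^⊥ of the tangent plane equals (C / Σ_j λ_j² x_j²) · (λ_1 x_1 e^{iλ_1 s}, …, λ_n x_n e^{iλ_n s}). Consequently, if Λ := Σ_j λ_j ≠ 0, then F^⊥ = (−C/Λ) · h(F(x,s)), where h(z) = −(Λ / Σ_j λ_j² |z_j|²)(λ_1 z_1, …, λ_n z_n) is the mean curvature vector of the submanifold; that is, L_C is a self-similar solution of the mean curvature flow. -/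
open Complex

theorem normSq_exp_I_mul_mul_ofReal (a b : ℝ) :
    Complex.normSq (Complex.exp (Complex.I * a * b)) = 1 := by
  rw [Complex.normSq_eq_norm_sq, Complex.norm_exp]
  simp

theorem re_mul_conj_of_normSq_eq_one {e : ℂ} (he : Complex.normSq e = 1) (r l x u a : ℝ) :
    ((r : ℂ) * ((l : ℂ) * x * e) *
      (starRingEnd ℂ) ((u : ℂ) * e + Complex.I * a * l * x * e)).re = r * (l * x * u) := by
  rw [Complex.normSq_apply] at he
  simp only [Complex.mul_re, Complex.mul_im, Complex.add_re, Complex.add_im, Complex.conj_re,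
    Complex.conj_im, Complex.ofReal_re, Complex.ofReal_im, Complex.I_re, Complex.I_im]
  linear_combination (r * l * x * u) * he

theorem sum_sq_mul_sq_pos {ι : Type*} [Fintype ι] {l x : ι → ℝ} (hl : ∀ j, l j ≠ 0)
    (hx : x ≠ 0) : 0 < ∑ j, l j ^ 2 * x j ^ 2 := by
  obtain ⟨k, hk⟩ := Function.ne_iff.mp hx
  have hlk := hl k
  have hxk : x k ≠ 0 := hk
  exact Finset.sum_pos' (fun j _ => by positivity) ⟨k, Finset.mem_univ k, by positivity⟩

/-- For `x ≠ 0` with `∑ λ_j x_j² = C`, the orthogonal projection of the position vector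
`F(x,s) = (x_j e^{iλ_j s})_j` onto the orthogonal complement of the tangent plane
`T(x,s)` is `N = (C / ∑ λ_j² x_j²) (λ_1 x_1 e^{iλ_1 s}, …, λ_n x_n e^{iλ_n s})`:
`N` is orthogonal to every tangent vector and `F − N` is tangent.  Consequently, if
`Λ = ∑ λ_j ≠ 0`, then `F^⊥ = (−C/Λ) h(F(x,s))` where
`h(z) = −(Λ / ∑ λ_j² |z_j|²)(λ_1 z_1, …, λ_n z_n)` is the mean curvature vector;
i.e. `L_C` is a self-similar solution of the mean curvature flow. -/
theorem stmt3 (n : ℕ) (hn : 2 ≤ n) (lam : Fin n → ℝ) (hlam : ∀ j, lam j ≠ 0) (C : ℝ)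
    (x : Fin n → ℝ) (hx : x ≠ 0) (hxC : ∑ j, lam j * x j ^ 2 = C) (s : ℝ)
    (N : Fin n → ℂ)
    (hN : ∀ j, N j = ((C / ∑ l, lam l ^ 2 * x l ^ 2 : ℝ) : ℂ)
      * ((lam j : ℂ) * x j * Complex.exp (Complex.I * lam j * s))) :
    ((∀ (u : Fin n → ℝ) (a : ℝ), ∑ j, lam j * x j * u j = 0 →
        ∑ j, (N j * (starRingEnd ℂ)
          ((u j : ℂ) * Complex.exp (Complex.I * lam j * s)
            + Complex.I * a * lam j * x j * Complex.exp (Complex.I * lam j * s))).re = 0)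
      ∧ ∃ (u : Fin n → ℝ) (a : ℝ), (∑ j, lam j * x j * u j = 0) ∧
          ∀ j, (x j : ℂ) * Complex.exp (Complex.I * lam j * s) - N j
            = (u j : ℂ) * Complex.exp (Complex.I * lam j * s)
              + Complex.I * a * lam j * x j * Complex.exp (Complex.I * lam j * s))
    ∧ ((∑ j, lam j) ≠ 0 → ∀ j, N j = ((-C / ∑ l, lam l : ℝ) : ℂ) *
        (((-(∑ l, lam l) / ∑ l, lam l ^ 2 *
            Complex.normSq ((x l : ℂ) * Complex.exp (Complex.I * lam l * s)) : ℝ) : ℂ)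
          * ((lam j : ℂ) * ((x j : ℂ) * Complex.exp (Complex.I * lam j * s))))) := by
  have hS := (sum_sq_mul_sq_pos hlam hx).ne'
  refine ⟨⟨fun u a hu => ?_, ?_⟩, fun hL j => ?_⟩
  · simp_rw [hN, re_mul_conj_of_normSq_eq_one (normSq_exp_I_mul_mul_ofReal _ _)]
    rw [← Finset.mul_sum, hu, mul_zero]
  · refine ⟨fun j => x j - C / (∑ l, lam l ^ 2 * x l ^ 2) * (lam j * x j), 0, ?_, fun j => ?_⟩
    · calc
        _ = ∑ j, lam j * x j ^ 2
            - C / (∑ l, lam l ^ 2 * x l ^ 2) * ∑ j, lam j ^ 2 * x j ^ 2 := by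
          rw [Finset.mul_sum, ← Finset.sum_sub_distrib]
          exact Finset.sum_congr rfl fun j _ => by ring
        _ = 0 := by rw [hxC, div_mul_cancel₀ _ hS, sub_self]
    · rw [hN]
      simp only [Complex.ofReal_sub, Complex.ofReal_mul, Complex.ofReal_zero]
      ring
  · have hsq : ∀ l, Complex.normSq ((x l : ℂ) * Complex.exp (Complex.I * lam l * s)) =
        x l ^ 2 := fun l => by
      rw [Complex.normSq_mul, normSq_exp_I_mul_mul_ofReal, Complex.normSq_ofReal, mul_one, sq]
    simp_rw [hsq]
    have hc : C / (∑ l, lam l ^ 2 * x l ^ 2) =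
        -C / (∑ l, lam l) * (-(∑ l, lam l) / ∑ l, lam l ^ 2 * x l ^ 2) := by
      field_simp
    rw [hN, hc, Complex.ofReal_mul]
    ring
end

section
/- Let x ∈ ℝⁿ, x ≠ 0, and s ∈ ℝ. Let u_1, …, u_{n−1} be any orthonormal basis (in ℝⁿ) of the hyperplane {u ∈ ℝⁿ : Σ_j λ_j x_j u_j = 0}, and set b_a = (u_{a,1} e^{iλ_1 s}, …, u_{a,n} e^{iλ_n s}) for a = 1, …, n−1 and b_n = ∂F/∂s(x,s) = (iλ_1 x_1 e^{iλ_1 s}, …, iλ_n x_n e^{iλ_n s}). Then the Gram determinant det(⟨b_a, b_c⟩)_{1 ≤ a,c ≤ n} equals Σ_j λ_j² x_j². Hence the volume density of the parametrization F of L_C relative to the product of the hypersurface measure on {Σ_j λ_j x_j² = C} and ds is √(Σ_j λ_j² x_j²). -/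
open Complex

/-- A common phase `e^{it}` does not affect the real inner product of two complex numbers. -/
theorem re_mul_exp_mul_conj (z w : ℂ) (l s : ℝ) :
    (z * Complex.exp (Complex.I * l * s) *
        (starRingEnd ℂ) (w * Complex.exp (Complex.I * l * s))).re
      = z.re * w.re + z.im * w.im := by
  have h : Complex.exp (Complex.I * l * s) *
      (starRingEnd ℂ) (Complex.exp (Complex.I * l * s)) = 1 := by
    rw [← Complex.exp_conj, ← Complex.exp_add]
    simp
  rw [map_mul, mul_mul_mul_comm, h, mul_one]
  simp

/-- Let `u_1, …, u_{n−1}` be an orthonormal basis of the hyperplane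
`{u ∈ ℝⁿ : ∑ λ_j x_j u_j = 0}` and set `b_a = (u_{a,j} e^{iλ_j s})_j` for `a ≤ n−1`,
`b_n = ∂F/∂s = (iλ_j x_j e^{iλ_j s})_j`.  Then the Gram determinant
`det(⟨b_a, b_c⟩)` (real inner product `⟨z,w⟩ = Re ∑ z_j conj(w_j)` on ℂⁿ) equals
`∑ λ_j² x_j²`; hence the volume density of `F` relative to the product of the hypersurface
measure on `{∑ λ_j x_j² = C}` and `ds` is `√(∑ λ_j² x_j²)`. -/
theorem stmt4 (n : ℕ) (hn : 2 ≤ n) (lam : Fin n → ℝ) (hlam : ∀ j, lam j ≠ 0) (C : ℝ)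
    (x : Fin n → ℝ) (hx : x ≠ 0) (hxC : ∑ j, lam j * x j ^ 2 = C) (s : ℝ)
    (u : Fin (n - 1) → Fin n → ℝ)
    (hmem : ∀ a, ∑ j, lam j * x j * u a j = 0)
    (hON : ∀ a c, (∑ j, u a j * u c j) = if a = c then (1 : ℝ) else 0)
    (b : (Fin (n - 1) ⊕ Unit) → Fin n → ℂ)
    (hb1 : ∀ (a : Fin (n - 1)) (j : Fin n),
      b (Sum.inl a) j = (u a j : ℂ) * Complex.exp (Complex.I * lam j * s))
    (hb2 : ∀ j : Fin n,
      b (Sum.inr ()) j = Complex.I * lam j * x j * Complex.exp (Complex.I * lam j * s)) :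
    Matrix.det (Matrix.of fun p q : Fin (n - 1) ⊕ Unit =>
        ∑ j, (b p j * (starRingEnd ℂ) (b q j)).re)
      = ∑ j, lam j ^ 2 * x j ^ 2 := by
  have hblocks : (Matrix.of fun p q : Fin (n - 1) ⊕ Unit =>
        ∑ j, (b p j * (starRingEnd ℂ) (b q j)).re)
      = Matrix.fromBlocks 1 0 0 (Matrix.of fun _ _ : Unit => ∑ j, lam j ^ 2 * x j ^ 2) := by
    ext (a | ⟨⟩) (c | ⟨⟩)
    · simp only [Matrix.of_apply, hb1, re_mul_exp_mul_conj]
      simp [hON, Matrix.one_apply]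
    · simp only [Matrix.of_apply, hb1, hb2, re_mul_exp_mul_conj]
      simp
    · simp only [Matrix.of_apply, hb1, hb2, re_mul_exp_mul_conj]
      simp
    · simp only [Matrix.of_apply, hb2, re_mul_exp_mul_conj]
      simp [← sq, mul_pow]
  rw [hblocks, Matrix.det_fromBlocks_zero₂₁]
  simp
end

section
/- Let 1 ≤ k < n, let λ_1, …, λ_n be nonzero integers with λ_j > 0 for j ≤ k and λ_j < 0 for j > k, and let C > 0. Let ψ : ℝⁿ → ℝⁿ be ψ(x) = ((−1)^{λ_1} x_1, …, (−1)^{λ_n} x_n), and let ℤ act on Σ_C × ℝ by m · (x, s) = (ψ^m(x), s + mπ). Then the quotient topological space (Σ_C × ℝ)/ℤ (which is the Lagrangian L' = {(x_1 e^{iλ_1 s}, …, x_n e^{iλ_n s}) : x ∈ Σ_C, 0 ≤ s < π} as an immersed manifold) is connected if and only if k ≥ 2 or λ_1 is odd. -/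
/-- The point of the quadric `∑ j, lam j * x j ^ 2 = C` on the `i`-th coordinate axis, on the
side given by the sign `ε`. -/
noncomputable def axisPoint {n : ℕ} (lam : Fin n → ℤ) (C : ℝ) (hC : 0 < C) (i : Fin n)
    (hi : 0 < lam i) (ε : ℝ) (hε : ε ^ 2 = 1) :
    {x : Fin n → ℝ // ∑ j, (lam j : ℝ) * x j ^ 2 = C} :=
  ⟨fun j => if j = i then ε * √(C / lam i) else 0, by
    have hi' : (0 : ℝ) < lam i := by exact_mod_cast hi
    rw [Finset.sum_eq_single i]
    · simp only [if_true]
      rw [mul_pow, hε, Real.sq_sqrt (by positivity)]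
      field_simp
    · intro j _ hj
      simp [hj]
    · simp⟩

/-- A point of the quadric whose `i`-th coordinate has sign `ε` (or vanishes) is joined to the
axis point of sign `ε`, by scaling down all the other coordinates. -/
theorem joined_axisPoint {n : ℕ} (lam : Fin n → ℤ) (C : ℝ) (hC : 0 < C) (i : Fin n)
    (hi : 0 < lam i) (ε : ℝ) (hε : ε ^ 2 = 1)
    (x : {x : Fin n → ℝ // ∑ j, (lam j : ℝ) * x j ^ 2 = C}) (hx : ε * |x.1 i| = x.1 i) :
    Joined (axisPoint lam C hC i hi ε hε) x := by
  have hi' : (0 : ℝ) < lam i := by exact_mod_cast hi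
  obtain ⟨x, hxC⟩ := x
  simp only at hx
  set S : ℝ := ∑ j ∈ Finset.univ.erase i, (lam j : ℝ) * x j ^ 2 with hS
  have hsum : (lam i : ℝ) * x i ^ 2 + S = C := by
    rw [← hxC, hS]
    exact Finset.add_sum_erase _ (fun j => (lam j : ℝ) * x j ^ 2) (Finset.mem_univ i)
  have hSC : S ≤ C := by nlinarith [sq_nonneg (x i)]
  have hnonneg : ∀ t : unitInterval, 0 ≤ C - (t : ℝ) ^ 2 * S := by
    intro t
    have h0 : 0 ≤ (t : ℝ) ^ 2 := by positivity
    have h1 : (t : ℝ) ^ 2 ≤ 1 := pow_le_one₀ t.2.1 t.2.2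
    nlinarith
  refine ⟨{ toFun := fun t => ⟨fun j => if j = i then ε * √((C - (t : ℝ) ^ 2 * S) / lam i)
              else (t : ℝ) * x j, ?_⟩
            continuous_toFun := ?_
            source' := ?_
            target' := ?_ }⟩
  · rw [← Finset.add_sum_erase _ _ (Finset.mem_univ i)]
    simp only [if_true]
    rw [mul_pow, hε, Real.sq_sqrt (div_nonneg (hnonneg t) hi'.le)]
    have : ∑ j ∈ Finset.univ.erase i, (lam j : ℝ) * (if j = i then
        ε * √((C - (t : ℝ) ^ 2 * S) / lam i) else (t : ℝ) * x j) ^ 2 = (t : ℝ) ^ 2 * S := by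
      rw [hS, Finset.mul_sum]
      refine Finset.sum_congr rfl fun j hj => ?_
      rw [if_neg (Finset.ne_of_mem_erase hj)]
      ring
    rw [this]
    field_simp
    ring
  · refine Continuous.subtype_mk (continuous_pi fun j => ?_) _
    by_cases hj : j = i
    · simp only [hj, if_true]
      fun_prop
    · simp only [hj, if_false]
      fun_prop
  · simp [axisPoint]
  · refine Subtype.ext (funext fun j => ?_)
    by_cases hj : j = i
    · subst hj
      have : (C - S) / lam j = x j ^ 2 := by
        field_simp
        linarith
      simp [this, Real.sqrt_sq_eq_abs, hx]
    · simp [hj]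


/-- Let `1 ≤ k < n`, `λ_j` nonzero integers with `λ_j > 0` for `j ≤ k`, `λ_j < 0` for `j > k`,
and `C > 0`.  Let `ℤ` act on `Σ_C × ℝ` by `m · (x,s) = (ψ^m(x), s + mπ)` where
`ψ(x) = ((−1)^{λ_1} x_1, …, (−1)^{λ_n} x_n)`.  Then the quotient topological space
`(Σ_C × ℝ)/ℤ` (the immersed Lagrangian `L'`) is connected if and only if `k ≥ 2` or
`λ_1` is odd.  Here the quotient is realized as `Quot r`, where `r` relates `p` to each of
its translates `m · p`. -/
theorem stmt8 (n k : ℕ) (hk : 1 ≤ k) (hkn : k < n) (lam : Fin n → ℤ)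
    (hlam : ∀ j, lam j ≠ 0)
    (hpos : ∀ j : Fin n, (j : ℕ) < k → 0 < lam j)
    (hneg : ∀ j : Fin n, k ≤ (j : ℕ) → lam j < 0)
    (C : ℝ) (hC : 0 < C)
    (r : ({x : Fin n → ℝ // ∑ j, (lam j : ℝ) * x j ^ 2 = C} × ℝ) →
         ({x : Fin n → ℝ // ∑ j, (lam j : ℝ) * x j ^ 2 = C} × ℝ) → Prop)
    (hr : ∀ p q, r p q ↔ ∃ m : ℤ,
      ((q.1 : Fin n → ℝ) = fun j => (-1 : ℝ) ^ (lam j * m) * (p.1 : Fin n → ℝ) j)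
      ∧ q.2 = p.2 + m * Real.pi) :
    ConnectedSpace (Quot r) ↔ (2 ≤ k ∨ Odd (lam ⟨0, by omega⟩)) := by
  set i : Fin n := ⟨0, by omega⟩ with hidef
  have hi : 0 < lam i := hpos i (by simp [hidef]; omega)
  have hi' : (0 : ℝ) < lam i := by exact_mod_cast hi
  have hsqrt : 0 < √(C / lam i) := Real.sqrt_pos.2 (by positivity)
  set e := axisPoint lam C hC i hi with he
  have h1 : (1 : ℝ) ^ 2 = 1 := by norm_num
  have h2 : (-1 : ℝ) ^ 2 = 1 := by norm_num
  constructor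
  · intro hconn
    by_contra! hcon
    obtain ⟨hk2, hodd⟩ := hcon
    have heven : Even (lam i) := Int.not_odd_iff_even.1 hodd
    have hinv : ∀ p q, r p q → p.1.1 i = q.1.1 i := by
      intro p q hpq
      obtain ⟨m, hm, -⟩ := (hr p q).1 hpq
      simp only [hm, (heven.mul_right m).neg_one_zpow, one_mul]
    have hcont : Continuous (Quot.lift _ hinv) :=
      continuous_quot_lift hinv
        ((continuous_apply i).comp (continuous_subtype_val.comp continuous_fst))
    obtain ⟨z, hz⟩ := mem_range_of_exists_le_of_exists_ge (c := 0) hcont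
      ⟨Quot.mk r (e (-1) h2, 0), by simp [he, axisPoint, hsqrt.le]⟩
      ⟨Quot.mk r (e 1 h1, 0), by simp [he, axisPoint, hsqrt.le]⟩
    induction z using Quot.ind with
    | mk p =>
      have hp : p.1.1 i = 0 := hz
      have hle : ∑ j, (lam j : ℝ) * p.1.1 j ^ 2 ≤ 0 := by
        refine Finset.sum_nonpos fun j _ => ?_
        by_cases hj : j = i
        · simp [hj, hp]
        · have hjk : k ≤ (j : ℕ) := by
            have : (j : ℕ) ≠ 0 := fun h => hj (Fin.ext h)
            omega
          have : (lam j : ℝ) < 0 := by exact_mod_cast hneg j hjk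
          exact mul_nonpos_of_nonpos_of_nonneg this.le (sq_nonneg _)
      linarith [p.1.2]
  · intro h
    have hjoin : ∀ (x y : {x : Fin n → ℝ // ∑ j, (lam j : ℝ) * x j ^ 2 = C}) (s t : ℝ),
        Joined x y → Joined (Quot.mk r (x, s)) (Quot.mk r (y, t)) := by
      intro x y s t hxy
      have hst : Joined s t := PathConnectedSpace.joined s t
      exact ⟨(hxy.somePath.prod hst.somePath).map continuous_quot_mk⟩
    have hneg_pos : Joined (Quot.mk r (e (-1) h2, 0)) (Quot.mk r (e 1 h1, 0)) := by
      rcases h with h | h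
      · have hlt : 1 < n := by omega
        have hl : 0 < lam ⟨1, hlt⟩ := hpos _ h
        have h0 : (axisPoint lam C hC ⟨1, hlt⟩ hl 1 h1).1 i = 0 := by
          simp [axisPoint, hidef]
        exact hjoin _ _ _ _
          ((joined_axisPoint lam C hC i hi (-1) h2
            (axisPoint lam C hC ⟨1, hlt⟩ hl 1 h1) (by simp [h0])).trans
            (joined_axisPoint lam C hC i hi 1 h1 _ (by simp [h0])).symm)
      · have hrel : r (e 1 h1, 0) (e (-1) h2, Real.pi) := by
          refine (hr _ _).2 ⟨1, funext fun j => ?_, by simp⟩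
          by_cases hj : j = i
          · simp [he, axisPoint, hj, h.neg_one_zpow]
          · simp [he, axisPoint, hj]
        rw [Quot.sound hrel]
        exact hjoin _ _ _ _ (Joined.refl _)
    have hall : ∀ z, Joined (Quot.mk r (e 1 h1, 0)) z := by
      intro z
      induction z using Quot.ind with
      | mk p =>
        obtain ⟨x, s⟩ := p
        rcases le_total 0 (x.1 i) with hx | hx
        · exact hjoin _ _ _ _
            (joined_axisPoint lam C hC i hi 1 h1 x (by rw [abs_of_nonneg hx, one_mul]))
        · exact hneg_pos.symm.trans (hjoin _ _ _ _
            (joined_axisPoint lam C hC i hi (-1) h2 x (by rw [abs_of_nonpos hx]; ring)))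
    have : PathConnectedSpace (Quot r) :=
      ⟨⟨Quot.mk r (e 1 h1, 0)⟩, fun y z => (hall y).symm.trans (hall z)⟩
    infer_instance
end

section
/- Let λ_1, …, λ_n be nonzero integers such that |λ_1|, …, |λ_n| are pairwise coprime. Suppose x, x' ∈ ℝⁿ are nonzero with Σ_j λ_j x_j² = 0 and Σ_j λ_j (x'_j)² = 0, and s, s' ∈ [0, π). If (x_1 e^{iλ_1 s}, …, x_n e^{iλ_n s}) = (x'_1 e^{iλ_1 s'}, …, x'_n e^{iλ_n s'}), then x = x' and s = s'. That is, the Hamiltonian stationary cone V_0 is embedded: the parametrization F(x,s) = (x_j e^{iλ_j s})_j is injective on (Σ_0 \ {0}) × [0, π). -/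
open Complex

/-- If two real multiples of points `e^{ia}`, `e^{ib}` of the unit circle agree and are nonzero,
then `sin (a - b) = 0`. -/
theorem sin_sub_eq_zero_of_real_mul_exp_eq {r r' a b : ℝ} (hr : r ≠ 0)
    (h : (r : ℂ) * Complex.exp (a * Complex.I) = (r' : ℂ) * Complex.exp (b * Complex.I)) :
    Real.sin (a - b) = 0 := by
  have hre := congrArg Complex.re h
  have him := congrArg Complex.im h
  rw [Complex.re_ofReal_mul, Complex.re_ofReal_mul, Complex.exp_ofReal_mul_I_re,
    Complex.exp_ofReal_mul_I_re] at hre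
  rw [Complex.im_ofReal_mul, Complex.im_ofReal_mul, Complex.exp_ofReal_mul_I_im,
    Complex.exp_ofReal_mul_I_im] at him
  refine (mul_eq_zero.mp ?_).resolve_left hr
  rw [Real.sin_sub]
  linear_combination Real.cos b * him - Real.sin b * hre

/-- If `sin (p t) = sin (q t) = 0` for coprime integers `p`, `q`, then `t` is an integer
multiple of `π`. -/
theorem exists_int_mul_pi_eq_of_sin_eq_zero {p q : ℤ} (hpq : IsCoprime p q) {t : ℝ}
    (hp : Real.sin (p * t) = 0) (hq : Real.sin (q * t) = 0) :
    ∃ m : ℤ, (m : ℝ) * Real.pi = t := by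
  obtain ⟨a, b, hab⟩ := hpq
  obtain ⟨m, hm⟩ := Real.sin_eq_zero_iff.mp hp
  obtain ⟨k, hk⟩ := Real.sin_eq_zero_iff.mp hq
  have hab' : (a : ℝ) * p + b * q = 1 := by exact_mod_cast hab
  refine ⟨a * m + b * k, ?_⟩
  push_cast
  linear_combination (a : ℝ) * hm + b * hk + t * hab'

/-- A nonzero zero of a diagonal quadratic form with nonzero coefficients has at least two
nonzero coordinates. -/
theorem exists_ne_coord_ne_zero_of_sum_mul_sq_eq_zero {ι : Type*} [Fintype ι] {c x : ι → ℝ}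
    (hc : ∀ j, c j ≠ 0) (hx : x ≠ 0) (h0 : ∑ j, c j * x j ^ 2 = 0) :
    ∃ j k, j ≠ k ∧ x j ≠ 0 ∧ x k ≠ 0 := by
  obtain ⟨j, hj⟩ := Function.ne_iff.mp hx
  by_contra! h
  have hsum : ∑ k, c k * x k ^ 2 = c j * x j ^ 2 :=
    Fintype.sum_eq_single j fun k hk => by simp [h j k hk.symm hj]
  exact mul_ne_zero (hc j) (pow_ne_zero 2 hj) (hsum.symm.trans h0)

/-- Let `λ_j` be nonzero integers with `|λ_1|, …, |λ_n|` pairwise coprime.  If `x, x'` are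
nonzero points of the cone `Σ_0 = {∑ λ_j x_j² = 0}` and `s, s' ∈ [0, π)` with
`(x_1 e^{iλ_1 s}, …, x_n e^{iλ_n s}) = (x'_1 e^{iλ_1 s'}, …, x'_n e^{iλ_n s'})`, then
`x = x'` and `s = s'`; i.e. the Hamiltonian stationary cone `V_0` is embedded: the
parametrization `F(x,s) = (x_j e^{iλ_j s})_j` is injective on `(Σ_0 \ {0}) × [0, π)`. -/
theorem stmt9 (n : ℕ) (hn : 2 ≤ n) (lam : Fin n → ℤ) (hlam : ∀ j, lam j ≠ 0)
    (hcop : ∀ j j' : Fin n, j ≠ j' → Nat.Coprime (lam j).natAbs (lam j').natAbs)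
    (x x' : Fin n → ℝ) (hx : x ≠ 0) (hx' : x' ≠ 0)
    (h0 : ∑ j, (lam j : ℝ) * x j ^ 2 = 0) (h0' : ∑ j, (lam j : ℝ) * x' j ^ 2 = 0)
    (s s' : ℝ) (hs : s ∈ Set.Ico 0 Real.pi) (hs' : s' ∈ Set.Ico 0 Real.pi)
    (heq : ∀ j, (x j : ℂ) * Complex.exp (Complex.I * (lam j : ℝ) * s)
      = (x' j : ℂ) * Complex.exp (Complex.I * (lam j : ℝ) * s')) :
    x = x' ∧ s = s' := by
  have hsin : ∀ j, x j ≠ 0 → Real.sin (lam j * (s - s')) = 0 := fun j hj => by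
    rw [mul_sub]
    refine sin_sub_eq_zero_of_real_mul_exp_eq (r' := x' j) hj ?_
    convert heq j using 3 <;> push_cast <;> ring
  obtain ⟨j, k, hjk, hj, hk⟩ := exists_ne_coord_ne_zero_of_sum_mul_sq_eq_zero
    (fun j => Int.cast_ne_zero.mpr (hlam j)) hx h0
  obtain ⟨m, hm⟩ := exists_int_mul_pi_eq_of_sin_eq_zero
    (Int.isCoprime_iff_nat_coprime.mpr (hcop j k hjk)) (hsin j hj) (hsin k hk)
  have hs_eq : s = s' := by
    have hsin0 : Real.sin (s - s') = 0 := Real.sin_eq_zero_iff.mpr ⟨m, hm⟩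
    have := (Real.sin_eq_zero_iff_of_lt_of_lt (by linarith [hs.1, hs'.2])
      (by linarith [hs.2, hs'.1])).mp hsin0
    linarith
  subst hs_eq
  refine ⟨funext fun j => ?_, rfl⟩
  exact_mod_cast mul_right_cancel₀ (Complex.exp_ne_zero _) (heq j)
end

section
/- For every x ∈ ℝⁿ, s ∈ ℝ, a, b ∈ ℝ, and u, v ∈ ℝⁿ satisfying Σ_j λ_j x_j u_j = 0 and Σ_j λ_j x_j v_j = 0, one has ω(P, Q) = 0, where P = (u_1 w_1(s) + a x_1 w_1'(s), …, u_n w_n(s) + a x_n w_n'(s)) and Q = (v_1 w_1(s) + b x_1 w_1'(s), …, v_n w_n(s) + b x_n w_n'(s)). In other words, the tangent planes of each level set L_C = {G(x,s) : Σ_j λ_j x_j² = C} are Lagrangian subspaces of ℂⁿ. -/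
open Complex Finset

/-- The standard symplectic form on `ℂ`, evaluated on real combinations of `z` and `y`. -/
lemma im_conj_mul_real_combination (p q r t : ℝ) (z y : ℂ) :
    ((starRingEnd ℂ) ((p : ℂ) * z + (r : ℂ) * y) * ((q : ℂ) * z + (t : ℂ) * y)).im =
      (p * t - r * q) * ((starRingEnd ℂ) z * y).im := by
  simp
  ring

/-- For the Joyce–Lee–Tsui ansatz `G(x,s) = (x_1 w_1(s), …, x_n w_n(s))`, where
`w_j : ℝ → ℂ \ {0}` and `θ : ℝ → ℝ` satisfy `w_j' = λ_j e^{iθ} conj(w_1 ⋯ ŵ_j ⋯ w_n)` and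
`θ' = α Im(e^{−iθ} w_1 ⋯ w_n)`, the tangent planes of each level set
`L_C = {G(x,s) : ∑ λ_j x_j² = C}` are Lagrangian: for tangent vectors
`P = (u_j w_j(s) + a x_j w_j'(s))_j` and `Q = (v_j w_j(s) + b x_j w_j'(s))_j` with
`∑ λ_j x_j u_j = 0 = ∑ λ_j x_j v_j`, the standard symplectic form
`ω(P,Q) = ∑ Im(conj(P_j) Q_j)` vanishes. -/
theorem stmt15 (n k : ℕ) (hn : 2 ≤ n) (hk : 1 ≤ k) (hkn : k < n)
    (lam : Fin n → ℝ)
    (hpos : ∀ j : Fin n, (j : ℕ) < k → 0 < lam j)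
    (hneg : ∀ j : Fin n, k ≤ (j : ℕ) → lam j < 0)
    (α : ℝ) (w : Fin n → ℝ → ℂ) (θ : ℝ → ℝ)
    (hw : ∀ (j : Fin n) (s : ℝ), w j s ≠ 0)
    (hodew : ∀ (j : Fin n) (s : ℝ), HasDerivAt (w j)
      ((lam j : ℂ) * Complex.exp (Complex.I * θ s)
        * (starRingEnd ℂ) (∏ l ∈ Finset.univ.erase j, w l s)) s)
    (hodeθ : ∀ s : ℝ, HasDerivAt θ
      (α * (Complex.exp (-Complex.I * θ s) * ∏ l, w l s).im) s)
    (x : Fin n → ℝ) (s a b : ℝ) (u v : Fin n → ℝ)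
    (hu : ∑ j, lam j * x j * u j = 0) (hv : ∑ j, lam j * x j * v j = 0) :
    ∑ j, ((starRingEnd ℂ)
        ((u j : ℂ) * w j s + (a : ℂ) * x j * deriv (w j) s) *
        ((v j : ℂ) * w j s + (b : ℂ) * x j * deriv (w j) s)).im = 0 := by
  set M : ℂ := Complex.exp (Complex.I * θ s) * (starRingEnd ℂ) (∏ l, w l s)
  have hconj (j : Fin n) : ((starRingEnd ℂ) (w j s) * deriv (w j) s).im = lam j * M.im := by
    have h : (starRingEnd ℂ) (w j s) * deriv (w j) s = (lam j : ℂ) * M := by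
      simp only [M]
      rw [(hodew j s).deriv, ← Finset.mul_prod_erase univ (fun l => w l s) (mem_univ j), map_mul]
      ring
    rw [h, Complex.im_ofReal_mul]
  calc
    _ = ∑ j, (b * M.im * (lam j * x j * u j) - a * M.im * (lam j * x j * v j)) := by
      refine Finset.sum_congr rfl fun j _ => ?_
      rw [← Complex.ofReal_mul, ← Complex.ofReal_mul, im_conj_mul_real_combination, hconj]
      ring
    _ = 0 := by
      rw [Finset.sum_sub_distrib, ← Finset.mul_sum, ← Finset.mul_sum, hu, hv]
      ring
end

section
/- Let x ∈ ℝⁿ, x ≠ 0, and s ∈ ℝ. If v_1, …, v_n is any basis of the tangent plane T(x,s) that is orthonormal with respect to the real inner product on ℂⁿ, then the complex determinant of the n × n complex matrix with columns v_1, …, v_n equals ε · e^{iθ(s)} for some ε ∈ {1, −1}; that is, the Lagrangian angle of L_C at G(x,s) is θ(s). -/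
open Complex Finset

open scoped Matrix

/-- If `U y = 0` and `μ ⬝ y ≠ 0`, the determinant of the rank-one perturbation `U + c a μᵀ`
is linear in `c`. -/
theorem det_add_smul_vecMulVec_of_mulVec_eq_zero {ι K : Type*} [Fintype ι] [DecidableEq ι]
    [Field K] (U : Matrix ι ι K) (a μ y : ι → K) (c : K) (hU : U *ᵥ y = 0) (hy : μ ⬝ᵥ y ≠ 0) :
    (U + c • Matrix.vecMulVec a μ).det = c * (U + Matrix.vecMulVec a μ).det := by
  have key : U + c • Matrix.vecMulVec a μ = (U + Matrix.vecMulVec a μ) *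
      (1 + Matrix.vecMulVec (((c - 1) / (μ ⬝ᵥ y)) • y) μ) := by
    have h : (U + Matrix.vecMulVec a μ) *ᵥ (((c - 1) / (μ ⬝ᵥ y)) • y) = (c - 1) • a := by
      rw [Matrix.mulVec_smul, Matrix.add_mulVec, hU, zero_add]
      ext i
      simp only [Matrix.vecMulVec_mulVec, Pi.smul_apply, smul_eq_mul, MulOpposite.smul_eq_mul_unop,
        MulOpposite.unop_op]
      field_simp
    rw [mul_add, mul_one, Matrix.mul_vecMulVec, h, Matrix.smul_vecMulVec, sub_smul, one_smul]
    abel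
  rw [key, Matrix.det_mul, Matrix.vecMulVec_eq Unit (_ • y),
    Matrix.det_one_add_replicateCol_mul_replicateRow, dotProduct_smul, smul_eq_mul,
    div_mul_cancel₀ _ hy]
  ring

/-- In the Joyce–Lee–Tsui setting (`w_j' = λ_j e^{iθ} conj(w_1 ⋯ ŵ_j ⋯ w_n)`,
`θ' = α Im(e^{−iθ} w_1 ⋯ w_n)`, `G(x,s) = (x_1 w_1(s), …, x_n w_n(s))`), for `x ≠ 0`:
if `v_1, …, v_n` are vectors in the tangent plane
`T(x,s) = {(u_j w_j(s) + a x_j w_j'(s))_j : ∑ λ_j x_j u_j = 0}` which are orthonormal for the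
real inner product `⟨z,w⟩ = Re ∑ z_j conj(w_j)` (hence an orthonormal basis of `T(x,s)`),
then the complex determinant of the matrix with columns `v_1, …, v_n` equals `ε e^{iθ(s)}`
with `ε = ±1`; i.e. the Lagrangian angle of `L_C` at `G(x,s)` is `θ(s)`. -/
theorem stmt16 (n k : ℕ) (hn : 2 ≤ n) (hk : 1 ≤ k) (hkn : k < n)
    (lam : Fin n → ℝ)
    (hpos : ∀ j : Fin n, (j : ℕ) < k → 0 < lam j)
    (hneg : ∀ j : Fin n, k ≤ (j : ℕ) → lam j < 0)
    (α : ℝ) (w : Fin n → ℝ → ℂ) (θ : ℝ → ℝ)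
    (hw : ∀ (j : Fin n) (s : ℝ), w j s ≠ 0)
    (hodew : ∀ (j : Fin n) (s : ℝ), HasDerivAt (w j)
      ((lam j : ℂ) * Complex.exp (Complex.I * θ s)
        * (starRingEnd ℂ) (∏ l ∈ Finset.univ.erase j, w l s)) s)
    (hodeθ : ∀ s : ℝ, HasDerivAt θ
      (α * (Complex.exp (-Complex.I * θ s) * ∏ l, w l s).im) s)
    (x : Fin n → ℝ) (hx : x ≠ 0) (s : ℝ)
    (v : Fin n → Fin n → ℂ)
    (hvT : ∀ i, ∃ (u : Fin n → ℝ) (a : ℝ), (∑ j, lam j * x j * u j = 0) ∧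
      ∀ j, v i j = (u j : ℂ) * w j s + (a : ℂ) * x j * deriv (w j) s)
    (hON : ∀ i i', (∑ j, (v i j * (starRingEnd ℂ) (v i' j)).re)
      = if i = i' then (1 : ℝ) else 0) :
    ∃ ε : ℝ, (ε = 1 ∨ ε = -1) ∧
      Matrix.det (Matrix.of fun j i => v i j)
        = (ε : ℂ) * Complex.exp (Complex.I * θ s) := by
  set c : ℂ := exp (I * θ s) * (starRingEnd ℂ) (∏ l, w l s) with hc
  set μ : Fin n → ℝ := fun j => lam j * x j / normSq (w j s) with hμ
  have hlam : ∀ j, lam j ≠ 0 := fun j => by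
    rcases lt_or_ge (j : ℕ) k with h | h
    · exact (hpos j h).ne'
    · exact (hneg j h).ne
  have hN : ∀ j, normSq (w j s) ≠ 0 := fun j => by simpa using hw j s
  choose u a hu hv using hvT
  have hderiv : ∀ j, x j * deriv (w j) s = μ j * c * w j s := fun j => by
    have hconj : (starRingEnd ℂ) (w j s) ≠ 0 := by simpa using hw j s
    rw [(hodew j s).deriv, hc, hμ, ← Finset.mul_prod_erase univ _ (mem_univ j)]
    push_cast
    rw [← mul_conj, map_mul]
    field_simp [hw j s]
  have hv' : ∀ i j, v i j = w j s * (u i j + c * (a i * μ j)) := fun i j => by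
    rw [hv, mul_assoc (a i : ℂ), hderiv]
    ring
  have him : ∀ i i', ∑ j, (v i j * (starRingEnd ℂ) (v i' j)).im = 0 := fun i i' => by
    have : ∀ j, (v i j * (starRingEnd ℂ) (v i' j)).im =
        c.im * a i * (lam j * x j * u i' j) - c.im * a i' * (lam j * x j * u i j) := fun j => by
      have h : lam j * x j = μ j * normSq (w j s) := by simp [hμ, hN j]
      rw [h, hv', hv', normSq_apply]
      simp
      ring
    simp_rw [this, Finset.sum_sub_distrib, ← Finset.mul_sum, hu]
    simp
  have hunit : (Matrix.of v) ∈ Matrix.unitaryGroup (Fin n) ℂ := by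
    rw [Matrix.mem_unitaryGroup_iff]
    ext i i'
    have h : ∑ j, v i j * (starRingEnd ℂ) (v i' j) = if i = i' then 1 else 0 := by
      apply Complex.ext
      · rw [re_sum, hON]; split_ifs <;> simp
      · rw [im_sum, him]; split_ifs <;> simp
    simpa [Matrix.mul_apply, Matrix.one_apply, Matrix.star_apply] using h
  set y : Fin n → ℝ := fun j => lam j * x j with hy
  have hμy : ∑ j, μ j * y j ≠ 0 := by
    obtain ⟨j, hj⟩ := Function.ne_iff.mp hx
    refine (Finset.sum_pos' (fun i _ => ?_) ⟨j, mem_univ j, ?_⟩).ne'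
    · have := normSq_nonneg (w i s)
      simp only [hμ, hy, div_mul_eq_mul_div, ← sq]
      positivity
    · have := normSq_pos.mpr (hw j s)
      have := mul_ne_zero (hlam j) hj
      simp only [hμ, hy, div_mul_eq_mul_div, ← sq]
      positivity
  set R : Matrix (Fin n) (Fin n) ℝ := Matrix.of u + Matrix.vecMulVec a μ with hR
  have hdet : (Matrix.of v).det = ((normSq (∏ l, w l s) * R.det : ℝ) : ℂ) * exp (I * θ s) := by
    have hfac : Matrix.of v = Matrix.of fun i j => w j s *
        ((Matrix.of fun i j => (u i j : ℂ)) +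
          c • Matrix.vecMulVec (fun i => (a i : ℂ)) (fun j => (μ j : ℂ))) i j := by
      ext i j
      simp [hv', Matrix.vecMulVec_apply]
    have hRmap : (Matrix.of fun i j => (u i j : ℂ)) +
        Matrix.vecMulVec (fun i => (a i : ℂ)) (fun j => (μ j : ℂ)) = ofRealHom.mapMatrix R := by
      ext i j
      simp [hR, Matrix.vecMulVec_apply]
    rw [hfac, Matrix.det_mul_row, det_add_smul_vecMulVec_of_mulVec_eq_zero _ _ _
      (fun j => (y j : ℂ)), hRmap, ← RingHom.map_det, hc]
    · push_cast
      rw [← mul_conj, ofRealHom_eq_coe]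
      ring
    · ext i
      have := hu i
      simp only [Matrix.mulVec, dotProduct, Matrix.of_apply, Pi.zero_apply]
      exact_mod_cast (Finset.sum_congr rfl fun j _ => mul_comm _ _).trans this
    · simp only [dotProduct]
      exact_mod_cast hμy
  refine ⟨normSq (∏ l, w l s) * R.det, ?_, (Matrix.det_transpose (Matrix.of v)).trans hdet⟩
  have hnorm : ‖(Matrix.of v).det‖ = 1 :=
    CStarRing.norm_of_mem_unitary (Matrix.det_of_mem_unitary hunit)
  rw [hdet, norm_mul, mul_comm I, norm_exp_ofReal_mul_I, mul_one, norm_real, Real.norm_eq_abs]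
    at hnorm
  exact eq_or_eq_neg_of_abs_eq hnorm
end

section
/- Let x ∈ ℝⁿ, x ≠ 0, with Σ_j λ_j x_j² = C, and s ∈ ℝ. Then α · (the orthogonal projection, with respect to the real inner product on ℂⁿ, of G(x,s) onto the orthogonal complement T(x,s)^⊥ of the tangent plane) = C · (θ'(s)/|∂G/∂s(x,s)|²) · (i · ∂G/∂s(x,s)), where ∂G/∂s(x,s) = (x_1 w_1'(s), …, x_n w_n'(s)). Equivalently, the position vector F = G and mean curvature vector H = J∇θ of L_C satisfy α F^⊥ = C H, so L_C is a Lagrangian self-similar solution of the mean curvature flow. -/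
open Complex Finset

/-- A linear form vanishing on the hyperplane orthogonal to `b` is a multiple of `b`. -/
theorem exists_eq_mul_of_sum_mul_eq_zero {ι : Type*} [Fintype ι] {b p : ι → ℝ} (hb : b ≠ 0)
    (h : ∀ u : ι → ℝ, ∑ j, b j * u j = 0 → ∑ j, p j * u j = 0) :
    ∃ t : ℝ, ∀ j, p j = t * b j := by
  have hB : ∑ j, b j * b j ≠ 0 := by
    intro h0
    refine hb (funext fun j => ?_)
    exact mul_self_eq_zero.1
      ((sum_eq_zero_iff_of_nonneg fun i _ => mul_self_nonneg (b i)).1 h0 j (mem_univ j))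
  set t : ℝ := (∑ j, b j * p j) / ∑ j, b j * b j with ht
  have hbu : ∑ j, b j * (p j - t * b j) = 0 := by
    have : ∑ j, b j * (p j - t * b j) = ∑ j, b j * p j - t * ∑ j, b j * b j := by
      rw [mul_sum, ← sum_sub_distrib]
      exact sum_congr rfl fun j _ => by ring
    rw [this, ht, div_mul_cancel₀ _ hB, sub_self]
  have hsq : ∑ j, (p j - t * b j) * (p j - t * b j) = 0 := by
    have : ∑ j, (p j - t * b j) * (p j - t * b j)
        = ∑ j, p j * (p j - t * b j) - t * ∑ j, b j * (p j - t * b j) := by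
      rw [mul_sum, ← sum_sub_distrib]
      exact sum_congr rfl fun j _ => by ring
    rw [this, h _ hbu, hbu, mul_zero, sub_zero]
  refine ⟨t, fun j => sub_eq_zero.1 (mul_self_eq_zero.1 ?_)⟩
  exact (sum_eq_zero_iff_of_nonneg fun i _ => mul_self_nonneg (p i - t * b i)).1 hsq j (mem_univ j)

/-- If `D j * conj (W j) = lam j * κ` for all `j`, the normal part of `(x j * W j)` with respect to
the plane spanned by `(x j * D j)` and the `(u j * W j)` with `∑ lam j * x j * u j = 0` is a real
multiple of `(I * (x j * D j))`. -/
theorem normal_part_eq {ι : Type*} [Fintype ι] {lam x : ι → ℝ} {W D N : ι → ℂ} {κ : ℂ}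
    (hlam : ∀ j, lam j ≠ 0) (hx : x ≠ 0) (hW : ∀ j, W j ≠ 0) (hκ : κ ≠ 0)
    (hD : ∀ j, D j * (starRingEnd ℂ) (W j) = lam j * κ)
    (hNperp : ∀ (u : ι → ℝ) (a : ℝ), ∑ j, lam j * x j * u j = 0 →
      ∑ j, (N j * (starRingEnd ℂ) ((u j : ℂ) * W j + (a : ℂ) * x j * D j)).re = 0)
    (hNtan : ∃ (u : ι → ℝ) (a : ℝ), (∑ j, lam j * x j * u j = 0) ∧
      ∀ j, (x j : ℂ) * W j - N j = (u j : ℂ) * W j + (a : ℂ) * x j * D j) (j : ι) :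
    N j = ((-(κ.im * ∑ l, lam l * x l ^ 2) / ∑ l, normSq ((x l : ℂ) * D l) : ℝ) : ℂ)
      * (I * ((x j : ℂ) * D j)) := by
  obtain ⟨u, a, hu, hN⟩ := hNtan
  have hWc : ∀ j, (starRingEnd ℂ) (W j) ≠ 0 := fun j => by simpa using hW j
  have hD0 : ∀ j, D j ≠ 0 := fun j h0 => by
    have := hD j
    simp [h0, hlam j, hκ] at this
  obtain ⟨i, hi⟩ := Function.ne_iff.1 hx
  have hS : 0 < ∑ l, normSq ((x l : ℂ) * D l) :=
    sum_pos' (fun l _ => normSq_nonneg _)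
      ⟨i, mem_univ i, normSq_pos.2 (mul_ne_zero (ofReal_ne_zero.2 hi) (hD0 i))⟩
  obtain ⟨t, ht⟩ : ∃ t : ℝ, ∀ j, (N j * (starRingEnd ℂ) (W j)).re = t * (lam j * x j) := by
    refine exists_eq_mul_of_sum_mul_eq_zero (b := fun j => lam j * x j)
      (Function.ne_iff.2 ⟨i, mul_ne_zero (hlam i) hi⟩) fun v hv => ?_
    rw [← hNperp v 0 hv]
    refine sum_congr rfl fun j _ => ?_
    simp
    ring
  have hNW : ∀ j, N j * (starRingEnd ℂ) (W j) = lam j * x j * (t - I * (a * κ.im)) := fun j => by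
    have h1 : N j * (starRingEnd ℂ) (W j)
        = ((x j - u j) * normSq (W j) : ℝ) - a * x j * (lam j * κ) := by
      push_cast
      rw [← mul_conj, ← hD j]
      linear_combination (-(starRingEnd ℂ) (W j)) * hN j
    apply Complex.ext
    · rw [ht j]
      simp
      ring
    · rw [h1]
      simp [-map_mul, -ofReal_mul]
      ring
  obtain ⟨z, hz⟩ : ∃ z : ℂ, ∀ j, N j = z * (x j * D j) := by
    refine ⟨(t - I * (a * κ.im)) / κ, fun j => mul_right_cancel₀ (hWc j) ?_⟩
    rw [hNW j, mul_assoc _ _ ((starRingEnd ℂ) (W j)), mul_assoc (x j : ℂ), hD j]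
    linear_combination (-(lam j : ℂ) * x j) * div_mul_cancel₀ ((t : ℂ) - I * (a * κ.im)) hκ
  have hzre : z.re = 0 := by
    have h1 := hNperp 0 1 (by simp)
    have h2 : ∀ j, (N j * (starRingEnd ℂ) (((0 : ι → ℝ) j : ℂ) * W j + ((1 : ℝ) : ℂ) * x j * D j)).re
        = z.re * normSq (x j * D j) := fun j => by
      rw [← re_mul_ofReal, ← mul_conj, hz j]
      congr 1
      simp
      ring
    simp only [h2, ← mul_sum] at h1
    exact (mul_eq_zero.1 h1).resolve_right hS.ne'
  have hzim : z.im * ∑ l, normSq ((x l : ℂ) * D l) = -(κ.im * ∑ l, lam l * x l ^ 2) := by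
    have h1 : ∀ j, z.im * normSq ((x j : ℂ) * D j)
        = -(κ.im * (lam j * x j ^ 2)) + κ.im * (lam j * x j * u j) := fun j => by
      have h2 : (starRingEnd ℂ z) * normSq ((x j : ℂ) * D j)
          = ((x j * (x j - u j) * lam j : ℝ) : ℂ) * κ - ((a * normSq ((x j : ℂ) * D j) : ℝ) : ℂ) := by
        have h3 := congrArg (starRingEnd ℂ) (hN j)
        rw [hz j] at h3
        simp only [map_sub, map_add, map_mul, conj_ofReal] at h3
        push_cast
        rw [← mul_conj, map_mul, conj_ofReal]
        linear_combination (-(x j : ℂ) * D j) * h3 + ((x j : ℂ) * (x j - u j)) * hD j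
      have h4 := congrArg Complex.im h2
      rw [im_mul_ofReal, sub_im, im_ofReal_mul, ofReal_im, conj_im] at h4
      linear_combination -h4
    rw [mul_sum, sum_congr rfl fun j _ => h1 j, sum_add_distrib, sum_neg_distrib, ← mul_sum,
      ← mul_sum, hu, mul_zero, add_zero]
  have hzI : z = (z.im : ℂ) * I := Complex.ext (by simp [hzre]) (by simp)
  rw [← hzim, mul_div_cancel_right₀ _ hS.ne', hz j]
  nth_rewrite 1 [hzI]
  ring

/-- In the Joyce–Lee–Tsui setting (`w_j' = λ_j e^{iθ} conj(w_1 ⋯ ŵ_j ⋯ w_n)`,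
`θ' = α Im(e^{−iθ} w_1 ⋯ w_n)`, `G(x,s) = (x_1 w_1(s), …, x_n w_n(s))`), for `x ≠ 0` with
`∑ λ_j x_j² = C`: if `N` is the orthogonal projection of `G(x,s)` onto the orthogonal
complement `T(x,s)^⊥` of the tangent plane (i.e. `N ⟂ T(x,s)` and `G − N ∈ T(x,s)`), then
`α N = C (θ'(s)/|∂G/∂s|²) (i ∂G/∂s)`, where `∂G/∂s = (x_1 w_1'(s), …, x_n w_n'(s))`.
Equivalently `α F^⊥ = C H`, so `L_C` is a Lagrangian self-similar solution of the mean
curvature flow. -/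
theorem stmt17 (n k : ℕ) (hn : 2 ≤ n) (hk : 1 ≤ k) (hkn : k < n)
    (lam : Fin n → ℝ)
    (hpos : ∀ j : Fin n, (j : ℕ) < k → 0 < lam j)
    (hneg : ∀ j : Fin n, k ≤ (j : ℕ) → lam j < 0)
    (α : ℝ) (w : Fin n → ℝ → ℂ) (θ : ℝ → ℝ)
    (hw : ∀ (j : Fin n) (s : ℝ), w j s ≠ 0)
    (hodew : ∀ (j : Fin n) (s : ℝ), HasDerivAt (w j)
      ((lam j : ℂ) * Complex.exp (Complex.I * θ s)
        * (starRingEnd ℂ) (∏ l ∈ Finset.univ.erase j, w l s)) s)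
    (hodeθ : ∀ s : ℝ, HasDerivAt θ
      (α * (Complex.exp (-Complex.I * θ s) * ∏ l, w l s).im) s)
    (C : ℝ) (x : Fin n → ℝ) (hx : x ≠ 0) (hxC : ∑ j, lam j * x j ^ 2 = C) (s : ℝ)
    (N : Fin n → ℂ)
    (hNperp : ∀ (u : Fin n → ℝ) (a : ℝ), ∑ j, lam j * x j * u j = 0 →
      ∑ j, (N j * (starRingEnd ℂ)
        ((u j : ℂ) * w j s + (a : ℂ) * x j * deriv (w j) s)).re = 0)
    (hNtan : ∃ (u : Fin n → ℝ) (a : ℝ), (∑ j, lam j * x j * u j = 0) ∧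
      ∀ j, (x j : ℂ) * w j s - N j
        = (u j : ℂ) * w j s + (a : ℂ) * x j * deriv (w j) s) :
    ∀ j, (α : ℂ) * N j
      = (C : ℂ) * ((deriv θ s / ∑ l, Complex.normSq ((x l : ℂ) * deriv (w l) s) : ℝ) : ℂ)
        * (Complex.I * ((x j : ℂ) * deriv (w j) s)) := by
  have hlam : ∀ j, lam j ≠ 0 := fun j =>
    (lt_or_ge (j : ℕ) k).elim (fun h => (hpos j h).ne') fun h => (hneg j h).ne
  have hprod : ∏ l, w l s ≠ 0 := prod_ne_zero_iff.2 fun l _ => hw l s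
  have hconj : (starRingEnd ℂ) (Complex.exp (-I * θ s) * ∏ l, w l s)
      = Complex.exp (I * θ s) * (starRingEnd ℂ) (∏ l, w l s) := by
    rw [map_mul, ← exp_conj]
    simp
  have hD : ∀ j, deriv (w j) s * (starRingEnd ℂ) (w j s)
      = lam j * (starRingEnd ℂ) (Complex.exp (-I * θ s) * ∏ l, w l s) := fun j => by
    rw [(hodew j s).deriv, hconj, ← prod_erase_mul univ (fun l => w l s) (mem_univ j), map_mul]
    ring
  have hκ : (starRingEnd ℂ) (Complex.exp (-I * θ s) * ∏ l, w l s) ≠ 0 :=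
    (map_ne_zero _).2 (mul_ne_zero (Complex.exp_ne_zero _) hprod)
  intro j
  rw [normal_part_eq hlam hx (fun j => hw j s) hκ hD hNperp hNtan j, hxC, conj_im,
    (hodeθ s).deriv]
  push_cast
  ring
end

section
/- For every x ∈ ℝⁿ and s ∈ ℝ: (i) for all u, v ∈ ℝⁿ, ⟨(u_1 w_1(s), …, u_n w_n(s)), (v_1 w_1(s), …, v_n w_n(s))⟩ = Σ_j u_j v_j |w_j(s)|²; (ii) for every u ∈ ℝⁿ with Σ_j λ_j x_j u_j = 0, ⟨(u_1 w_1(s), …, u_n w_n(s)), ∂G/∂s(x,s)⟩ = 0; (iii) |∂G/∂s(x,s)|² = (Π_{k=1}^n |w_k(s)|²) · Σ_j λ_j² x_j² / |w_j(s)|². In particular the induced metric on L_C is block diagonal with respect to the splitting into the x-directions and the s-direction. -/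
open Complex Finset

/-- In the Joyce–Lee–Tsui setting (`w_j' = λ_j e^{iθ} conj(w_1 ⋯ ŵ_j ⋯ w_n)`,
`θ' = α Im(e^{−iθ} w_1 ⋯ w_n)`, `G(x,s) = (x_1 w_1(s), …, x_n w_n(s))`,
`∂G/∂s = (x_1 w_1'(s), …, x_n w_n'(s))`, real inner product `⟨z,w⟩ = Re ∑ z_j conj(w_j)`):
(i) `⟨(u_j w_j(s))_j, (v_j w_j(s))_j⟩ = ∑ u_j v_j |w_j(s)|²`;
(ii) if `∑ λ_j x_j u_j = 0` then `⟨(u_j w_j(s))_j, ∂G/∂s(x,s)⟩ = 0`;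
(iii) `|∂G/∂s(x,s)|² = (∏ |w_l(s)|²) ∑ λ_j² x_j² / |w_j(s)|²`.
In particular the induced metric on `L_C` is block diagonal with respect to the splitting
into the `x`-directions and the `s`-direction. -/
theorem stmt18 (n k : ℕ) (hn : 2 ≤ n) (hk : 1 ≤ k) (hkn : k < n)
    (lam : Fin n → ℝ)
    (hpos : ∀ j : Fin n, (j : ℕ) < k → 0 < lam j)
    (hneg : ∀ j : Fin n, k ≤ (j : ℕ) → lam j < 0)
    (α : ℝ) (w : Fin n → ℝ → ℂ) (θ : ℝ → ℝ)
    (hw : ∀ (j : Fin n) (s : ℝ), w j s ≠ 0)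
    (hodew : ∀ (j : Fin n) (s : ℝ), HasDerivAt (w j)
      ((lam j : ℂ) * Complex.exp (Complex.I * θ s)
        * (starRingEnd ℂ) (∏ l ∈ Finset.univ.erase j, w l s)) s)
    (hodeθ : ∀ s : ℝ, HasDerivAt θ
      (α * (Complex.exp (-Complex.I * θ s) * ∏ l, w l s).im) s)
    (x : Fin n → ℝ) (s : ℝ) :
    (∀ u v : Fin n → ℝ,
      ∑ j, ((u j : ℂ) * w j s * (starRingEnd ℂ) ((v j : ℂ) * w j s)).re
        = ∑ j, u j * v j * Complex.normSq (w j s))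
    ∧ (∀ u : Fin n → ℝ, ∑ j, lam j * x j * u j = 0 →
      ∑ j, ((u j : ℂ) * w j s * (starRingEnd ℂ) ((x j : ℂ) * deriv (w j) s)).re = 0)
    ∧ ∑ j, Complex.normSq ((x j : ℂ) * deriv (w j) s)
        = (∏ l, Complex.normSq (w l s)) * ∑ j, lam j ^ 2 * x j ^ 2 / Complex.normSq (w j s)
    := by
  have hderiv j := (hodew j s).deriv
  have hprod j : w j s * ∏ l ∈ univ.erase j, w l s = ∏ l, w l s :=
    mul_prod_erase univ (fun l => w l s) (mem_univ j)
  refine ⟨fun u v => sum_congr rfl fun j _ => ?_, fun u hu => ?_, ?_⟩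
  · rw [← ofReal_re (u j * v j * normSq (w j s))]
    congr 1
    push_cast
    rw [normSq_eq_conj_mul_self, map_mul, conj_ofReal]
    ring
  · have hterm j : ((u j : ℂ) * w j s * (starRingEnd ℂ) ((x j : ℂ) * deriv (w j) s)).re
        = lam j * x j * u j * ((starRingEnd ℂ) (exp (I * θ s)) * ∏ l, w l s).re := by
      rw [hderiv, ← hprod j, ← re_ofReal_mul]
      congr 1
      simp only [map_mul, conj_ofReal, conj_conj]
      push_cast
      ring
    rw [sum_congr rfl fun j _ => hterm j, ← sum_mul, hu, zero_mul]
  · have hexp : normSq (exp (I * θ s)) = 1 := by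
      rw [normSq_eq_norm_sq, norm_exp_I_mul_ofReal, one_pow]
    rw [mul_sum]
    refine sum_congr rfl fun j _ => ?_
    have hne : normSq (w j s) ≠ 0 := normSq_eq_zero.not.mpr (hw j s)
    rw [hderiv, ← map_prod normSq, ← hprod j]
    simp only [map_mul, normSq_conj, hexp, normSq_ofReal]
    field_simp
end
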